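/- Let τ be a norm on ℝ², let E ⊂ ℝ² be a nonempty finite set and E̲ = (E₁,…,E_r) a partition of E. Then τ_{E̲} < ∞ and the infimum defining τ_{E̲} is attained: there exists a compact set F ∈ Ω_{E̲} with τ(F) = τ_{E̲}; moreover F can be chosen so that every connected component of F contains a point of E. -/

import Mathlib

open scoped ENNReal

/-- The plane `ℝ²`. -/
abbrev P2 : Type := ℝ × ℝ

/-- `τ : ℝ² → ℝ` is a norm. -/
structure IsNorm (τ : P2 → ℝ) : Prop where
  eq_zero_iff : ∀ x : P2, τ x = 0 ↔ x = 0
  smul_eq : ∀ (c : ℝ) (x : P2), τ (c • x) = |c| * τ x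
  add_le : ∀ x y : P2, τ (x + y) ≤ τ x + τ y

/-- `τ` is a strictly convex norm: `τ(x+y) < τ(x)+τ(y)` whenever `x` and `y` are not
nonnegative multiples of one another. -/
def IsStrictlyConvexNorm (τ : P2 → ℝ) : Prop :=
  IsNorm τ ∧ ∀ x y : P2, ¬ (∃ c : ℝ, 0 ≤ c ∧ (x = c • y ∨ y = c • x)) →
    τ (x + y) < τ x + τ y

/-- The `τ`-diameter of a set (in `ℝ≥0∞`). -/
noncomputable def tauDiam (τ : P2 → ℝ) (A : Set P2) : ℝ≥0∞ :=
  ⨆ x ∈ A, ⨆ y ∈ A, ENNReal.ofReal (τ (x - y))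

/-- The one-dimensional Hausdorff measure of `S` computed in the metric
`(x,y) ↦ τ(x−y)`: `lim_{ε→0} inf {Σ diam_τ(Aᵢ) : S ⊆ ⋃ Aᵢ, diam_τ(Aᵢ) ≤ ε}`. -/
noncomputable def tauLen (τ : P2 → ℝ) (S : Set P2) : ℝ≥0∞ :=
  ⨆ (ε : ℝ) (_ : 0 < ε),
    ⨅ (A : ℕ → Set P2) (_ : S ⊆ ⋃ i, A i)
      (_ : ∀ i, tauDiam τ (A i) ≤ ENNReal.ofReal ε),
      ∑' i, tauDiam τ (A i)

/-- `Ep` (a family `E₁,…,E_r`) is a partition of `E`: nonempty, pairwise disjoint pieces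
whose union is `E`. -/
def IsPartitionOf {r : ℕ} (Ep : Fin r → Set P2) (E : Set P2) : Prop :=
  (∀ j, (Ep j).Nonempty) ∧ (∀ j k, j ≠ k → Disjoint (Ep j) (Ep k)) ∧ (⋃ j, Ep j) = E

/-- `Ω_{E̲}`: compact sets `S` such that each `E_j` is contained in a single connected
component of `S`. -/
def OmegaSet {r : ℕ} (Ep : Fin r → Set P2) : Set (Set P2) :=
  {S | IsCompact S ∧ ∀ j, ∃ x ∈ S, Ep j ⊆ connectedComponentIn S x}

/-- `τ_{E̲} = inf {τ(S) : S ∈ Ω_{E̲}}`. -/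
noncomputable def tauMin (τ : P2 → ℝ) {r : ℕ} (Ep : Fin r → Set P2) : ℝ≥0∞ :=
  ⨅ S ∈ OmegaSet Ep, tauLen τ S

/-- `Ω^min_{E̲}`: the Steiner forests of `E̲`. -/
def OmegaMinSet (τ : P2 → ℝ) {r : ℕ} (Ep : Fin r → Set P2) : Set (Set P2) :=
  {S ∈ OmegaSet Ep | tauLen τ S = tauMin τ Ep}

/-- The box `Q_m = [−m,m]² ⊂ ℝ²`. -/
def Qbox (m : ℝ) : Set P2 := Set.Icc (-m) m ×ˢ Set.Icc (-m) m

/-- `Ω^min_{M,m}`: all Steiner forests `F ∈ Ω^min_{E̲}`, over `E ⊆ ∂Q_m` with `|E| ≤ M` and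
partitions `E̲` of `E`, each of whose connected components contains a point of `E`. -/
def OmegaMinMm (τ : P2 → ℝ) (M : ℕ) (m : ℝ) : Set (Set P2) :=
  {F | ∃ (E : Set P2) (r : ℕ) (Ep : Fin r → Set P2),
    E ⊆ frontier (Qbox m) ∧ E.Finite ∧ E.ncard ≤ M ∧ IsPartitionOf Ep E ∧
    F ∈ OmegaMinSet τ Ep ∧ ∀ x ∈ F, (connectedComponentIn F x ∩ E).Nonempty}

/-- The `τ`-Hausdorff "distance" `d_τ(A,B) = sup_{a∈A} inf_{b∈B} τ(a−b)` (in `ℝ≥0∞`). -/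
noncomputable def dTau (τ : P2 → ℝ) (A B : Set P2) : ℝ≥0∞ :=
  ⨆ a ∈ A, ⨅ b ∈ B, ENNReal.ofReal (τ (a - b))

namespace Steiner

variable {τ : P2 → ℝ}

lemma tzero (hτ : IsNorm τ) : τ 0 = 0 := (hτ.eq_zero_iff 0).2 rfl

lemma tneg (hτ : IsNorm τ) (x : P2) : τ (-x) = τ x := by
  have := hτ.smul_eq (-1) x
  simpa using this

lemma tcomm (hτ : IsNorm τ) (x y : P2) : τ (x - y) = τ (y - x) := by
  rw [← tneg hτ, neg_sub]

lemma tnonneg (hτ : IsNorm τ) (x : P2) : 0 ≤ τ x := by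
  have h := hτ.add_le x (-x)
  rw [add_neg_cancel, tzero hτ, tneg hτ] at h
  linarith

lemma ttri (hτ : IsNorm τ) (x y z : P2) : τ (x - z) ≤ τ (x - y) + τ (y - z) := by
  have h := hτ.add_le (x - y) (y - z)
  simpa using h

lemma tcont (hτ : IsNorm τ) : Continuous τ := by
  have hb : ∀ x : P2, τ x ≤ (τ (1, 0) + τ (0, 1)) * ‖x‖ := by
    intro x
    have hx : x = x.1 • ((1, 0) : P2) + x.2 • ((0, 1) : P2) := by
      ext <;> simp
    have h1 : |x.1| ≤ ‖x‖ := norm_fst_le x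
    have h2 : |x.2| ≤ ‖x‖ := norm_snd_le x
    calc τ x = τ (x.1 • ((1, 0) : P2) + x.2 • ((0, 1) : P2)) := by rw [← hx]
      _ ≤ |x.1| * τ (1, 0) + |x.2| * τ (0, 1) := by
        refine (hτ.add_le _ _).trans ?_
        rw [hτ.smul_eq, hτ.smul_eq]
      _ ≤ ‖x‖ * τ (1, 0) + ‖x‖ * τ (0, 1) := by
        gcongr <;> exact tnonneg hτ _
      _ = _ := by ring
  refine (LipschitzWith.of_dist_le_mul (K := (τ (1, 0) + τ (0, 1)).toNNReal) ?_).continuous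
  intro x y
  rw [Real.coe_toNNReal _ (add_nonneg (tnonneg hτ _) (tnonneg hτ _)), Real.dist_eq, dist_eq_norm]
  refine le_trans ?_ (hb (x - y))
  have h1 := ttri hτ x y 0
  have h2 := ttri hτ y x 0
  rw [tcomm hτ y x] at h2
  simp only [sub_zero] at h1 h2
  rw [abs_le]
  constructor <;> linarith

lemma tlower (hτ : IsNorm τ) : ∃ c > 0, ∀ x : P2, c * ‖x‖ ≤ τ x := by
  have hK : IsCompact (Metric.sphere (0 : P2) 1) := isCompact_sphere 0 1
  have hne : (Metric.sphere (0 : P2) 1).Nonempty := ⟨(1, 0), by simp [Prod.norm_def]⟩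
  obtain ⟨z, hz, hmin⟩ := hK.exists_isMinOn hne (tcont hτ).continuousOn
  have hz0 : z ≠ 0 := by
    rintro rfl
    simp at hz
  refine ⟨τ z, lt_of_le_of_ne (tnonneg hτ z) (fun h => hz0 ((hτ.eq_zero_iff z).1 h.symm)), ?_⟩
  intro x
  by_cases hx : x = 0
  · subst hx
    simp [tzero hτ]
  have hn : 0 < ‖x‖ := norm_pos_iff.2 hx
  have h := hmin (show (‖x‖⁻¹ • x) ∈ Metric.sphere (0 : P2) 1 by
    simp [norm_smul, hn.ne'])
  simp only [Set.mem_ofPred_eq] at h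
  rw [hτ.smul_eq, abs_of_pos (inv_pos.2 hn)] at h
  rw [inv_mul_eq_div, le_div_iff₀ hn] at h
  exact h

lemma tau_le_diam {A : Set P2} {x y : P2} (hx : x ∈ A) (hy : y ∈ A) :
    ENNReal.ofReal (τ (x - y)) ≤ tauDiam τ A :=
  le_iSup₂_of_le x hx (le_iSup₂_of_le y hy le_rfl)

lemma diam_le {A : Set P2} {d : ℝ≥0∞}
    (h : ∀ x ∈ A, ∀ y ∈ A, ENNReal.ofReal (τ (x - y)) ≤ d) : tauDiam τ A ≤ d :=
  iSup₂_le fun x hx => iSup₂_le fun y hy => h x hx y hy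

lemma diam_empty : tauDiam τ ∅ = 0 := by simp [tauDiam]

/-- upper bound for the length from covers -/
lemma len_le {S : Set P2} {L : ℝ≥0∞}
    (h : ∀ ε : ℝ, 0 < ε → ∃ A : ℕ → Set P2, S ⊆ ⋃ i, A i ∧
      (∀ i, tauDiam τ (A i) ≤ ENNReal.ofReal ε) ∧ ∑' i, tauDiam τ (A i) ≤ L) :
    tauLen τ S ≤ L := by
  refine iSup₂_le fun ε hε => ?_
  obtain ⟨A, h1, h2, h3⟩ := h ε hε
  exact iInf_le_of_le A (iInf_le_of_le h1 (iInf_le_of_le h2 h3))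

/-- covers from the length -/
lemma exists_cover {S : Set P2} {L : ℝ≥0∞} (h : tauLen τ S < L) {ε : ℝ} (hε : 0 < ε) :
    ∃ A : ℕ → Set P2, S ⊆ ⋃ i, A i ∧
      (∀ i, tauDiam τ (A i) ≤ ENNReal.ofReal ε) ∧ ∑' i, tauDiam τ (A i) < L := by
  have h' := lt_of_le_of_lt (le_iSup₂ (f := fun (ε : ℝ) (_ : 0 < ε) =>
    ⨅ (A : ℕ → Set P2) (_ : S ⊆ ⋃ i, A i)
      (_ : ∀ i, tauDiam τ (A i) ≤ ENNReal.ofReal ε), ∑' i, tauDiam τ (A i)) ε hε) h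
  simp only [iInf_lt_iff] at h'
  obtain ⟨A, h1, h2, h3⟩ := h'
  exact ⟨A, h1, h2, h3⟩

lemma len_union (S T : Set P2) : tauLen τ (S ∪ T) ≤ tauLen τ S + tauLen τ T := by
  by_cases hS : tauLen τ S = ⊤
  · simp [hS]
  by_cases hT : tauLen τ T = ⊤
  · simp [hT]
  refine ENNReal.le_of_forall_pos_le_add fun η hη _ => ?_
  have hη2 : ((η / 2 : NNReal) : ℝ≥0∞) ≠ 0 := by
    simpa using hη.ne'
  refine len_le fun ε hε => ?_
  obtain ⟨A, a1, a2, a3⟩ := exists_cover (ENNReal.lt_add_right hS hη2) hε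
  obtain ⟨B, b1, b2, b3⟩ := exists_cover (ENNReal.lt_add_right hT hη2) hε
  let e := Equiv.natSumNatEquivNat
  refine ⟨fun n => Sum.elim A B (e.symm n), ?_, ?_, ?_⟩
  · rintro x (hx | hx)
    · obtain ⟨i, hi⟩ := Set.mem_iUnion.1 (a1 hx)
      refine Set.mem_iUnion.2 ⟨e (Sum.inl i), ?_⟩
      simpa using hi
    · obtain ⟨i, hi⟩ := Set.mem_iUnion.1 (b1 hx)
      refine Set.mem_iUnion.2 ⟨e (Sum.inr i), ?_⟩
      simpa using hi
  · intro n
    dsimp only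
    rcases e.symm n with i | i
    · exact a2 i
    · exact b2 i
  · have h1 : ∑' n, tauDiam τ (Sum.elim A B (e.symm n)) =
        ∑' s : ℕ ⊕ ℕ, tauDiam τ (Sum.elim A B s) :=
      e.symm.tsum_eq (fun s => tauDiam τ (Sum.elim A B s))
    rw [h1, ENNReal.summable.tsum_sum ENNReal.summable]
    refine (add_le_add a3.le b3.le).trans (le_of_eq ?_)
    have : (η : ℝ≥0∞) = ((η / 2 : NNReal) : ℝ≥0∞) + ((η / 2 : NNReal) : ℝ≥0∞) := by
      rw [← ENNReal.coe_add, add_halves]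
    rw [this]
    exact add_add_add_comm _ _ _ _

lemma len_empty : tauLen τ ∅ = 0 := by
  refine le_antisymm (len_le fun ε _ => ⟨fun _ => ∅, by simp, ?_, ?_⟩) (zero_le)
  · simp [diam_empty]
  · simp [diam_empty]

lemma len_biUnion {ι : Type*} [DecidableEq ι] (s : Finset ι) (F : ι → Set P2) :
    tauLen τ (⋃ i ∈ s, F i) ≤ ∑ i ∈ s, tauLen τ (F i) := by
  induction s using Finset.induction_on with
  | empty => simp [len_empty]
  | insert a s ha ih =>
    rw [Finset.set_biUnion_insert, Finset.sum_insert ha]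
    exact (len_union _ _).trans (add_le_add le_rfl ih)

lemma len_segment (hτ : IsNorm τ) (p q : P2) :
    tauLen τ (segment ℝ p q) ≤ ENNReal.ofReal (τ (p - q)) := by
  refine len_le fun ε hε => ?_
  obtain ⟨n, hn⟩ := exists_nat_gt (τ (p - q) / ε)
  have hn0 : (0 : ℝ) < n := lt_of_le_of_lt (div_nonneg (tnonneg hτ _) hε.le) hn
  have hle : τ (p - q) / n ≤ ε := by
    rw [div_lt_iff₀ hε] at hn
    rw [div_le_iff₀ hn0]
    linarith
  have hdiam : ∀ i : ℕ, tauDiam τ (AffineMap.lineMap p q '' Set.Icc ((i : ℝ) / n) ((i + 1 : ℝ) / n))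
      ≤ ENNReal.ofReal (τ (p - q) / n) := by
    intro i
    refine diam_le ?_
    rintro _ ⟨s, ⟨hs1, hs2⟩, rfl⟩ _ ⟨t, ⟨ht1, ht2⟩, rfl⟩
    refine ENNReal.ofReal_le_ofReal ?_
    have : (AffineMap.lineMap p q s : P2) - AffineMap.lineMap p q t = (t - s) • (p - q) := by
      simp only [AffineMap.lineMap_apply_module]
      module
    rw [this, hτ.smul_eq]
    have h3 : |t - s| ≤ 1 / n := by
      have : ((i : ℝ) + 1) / n = i / n + 1 / n := by ring
      rw [abs_le]
      constructor <;> linarith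
    calc |t - s| * τ (p - q) ≤ 1 / n * τ (p - q) := by
          gcongr
          exact tnonneg hτ _
      _ = _ := by ring
  refine ⟨fun i => if i < n then
    AffineMap.lineMap p q '' Set.Icc ((i : ℝ) / n) ((i + 1 : ℝ) / n) else ∅, ?_, ?_, ?_⟩
  · rw [segment_eq_image_lineMap]
    rintro _ ⟨t, ⟨ht0, ht1⟩, rfl⟩
    rw [Set.mem_iUnion]
    have hn1 : 1 ≤ n := by
      have : 0 < n := by exact_mod_cast hn0
      omega
    rcases ht1.lt_or_eq with h | h
    · have hfl := Nat.floor_le (mul_nonneg ht0 hn0.le)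
      have hfl2 := Nat.lt_floor_add_one (t * n)
      have hlt : ⌊t * n⌋₊ < n := by
        rw [Nat.floor_lt (mul_nonneg ht0 hn0.le)]
        nlinarith
      refine ⟨⌊t * n⌋₊, ?_⟩
      rw [if_pos hlt]
      refine ⟨t, ⟨?_, ?_⟩, rfl⟩
      · rw [div_le_iff₀ hn0]
        exact hfl
      · rw [le_div_iff₀ hn0]
        exact hfl2.le
    · refine ⟨n - 1, ?_⟩
      rw [if_pos (by omega)]
      refine ⟨t, ⟨?_, ?_⟩, rfl⟩
      · rw [div_le_iff₀ hn0, h, Nat.cast_sub hn1]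
        push_cast
        linarith
      · rw [le_div_iff₀ hn0, h, Nat.cast_sub hn1]
        push_cast
        linarith
  · intro i
    dsimp only
    split_ifs
    · exact (hdiam i).trans (ENNReal.ofReal_le_ofReal hle)
    · simp [diam_empty]
  · rw [tsum_eq_sum (s := Finset.range n)]
    · calc _ ≤ ∑ i ∈ Finset.range n, ENNReal.ofReal (τ (p - q) / n) := by
            refine Finset.sum_le_sum fun i hi => ?_
            dsimp only
            rw [if_pos (Finset.mem_range.1 hi)]
            exact hdiam i
        _ = ENNReal.ofReal (τ (p - q)) := by
            rw [Finset.sum_const, Finset.card_range, ← ENNReal.ofReal_nsmul]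
            congr 1
            rw [nsmul_eq_mul]
            field_simp
    · intro i hi
      dsimp only
      rw [if_neg (fun h => hi (Finset.mem_range.2 h)), diam_empty]

/-- Shapes of Steiner trees: binary trees with terminals at the leaves. -/
inductive Shape : Type
  | leaf : P2 → Shape
  | node : Shape → Shape → Shape

/-- The terminals of a shape. -/
noncomputable def leaves : Shape → Multiset P2
  | .leaf e => {e}
  | .node S T => leaves S + leaves T

/-- Optimal cost of a tree of the given shape, rooted at `p`. -/
noncomputable def cost (τ : P2 → ℝ) : Shape → P2 → ℝ
  | .leaf e => fun p => τ (p - e)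
  | .node S T => fun p => ⨅ q : P2, (τ (p - q) + (cost τ S q + cost τ T q))

lemma leaves_pos (T : Shape) : 0 < (leaves T).card := by
  induction T with
  | leaf e => simp [leaves]
  | node S T h1 h2 =>
    simp only [leaves, Multiset.card_add]
    omega

lemma finite_shapes (n : ℕ) : ∀ X : Multiset P2, X.card = n → {T | leaves T = X}.Finite := by
  induction n using Nat.strong_induction_on with
  | _ n ih =>
    intro X hX
    have hB : (⋃ Y ∈ {Y : Multiset P2 | Y ≤ X ∧ Y.card < n}, {T | leaves T = Y}).Finite := by
      refine Set.Finite.biUnion ?_ ?_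
      · exact (Set.finite_Iic X).subset fun Y hY => hY.1
      · intro Y hY
        exact ih _ hY.2 Y rfl
    have hL : (Shape.leaf '' {e | e ∈ X}).Finite := by
      refine Set.Finite.image _ ?_
      classical
      exact X.toFinset.finite_toSet.subset fun e he => by simpa using he
    refine (hL.union (Set.Finite.image2 Shape.node hB hB)).subset ?_
    intro T hT
    rw [Set.mem_ofPred_eq] at hT
    cases T with
    | leaf e =>
      left
      refine ⟨e, ?_, rfl⟩
      rw [← hT]
      simp [leaves]
    | node S T =>
      right
      have h1 := leaves_pos S
      have h2 := leaves_pos T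
      simp only [leaves] at hT
      have h3 : (leaves S).card + (leaves T).card = n := by
        rw [← Multiset.card_add, hT, hX]
      refine ⟨S, ?_, T, ?_, rfl⟩
      · simp only [Set.mem_iUnion]
        refine ⟨leaves S, ⟨?_, by omega⟩, rfl⟩
        rw [← hT]
        exact Multiset.le_add_right _ _
      · simp only [Set.mem_iUnion]
        refine ⟨leaves T, ⟨?_, by omega⟩, rfl⟩
        rw [← hT]
        exact Multiset.le_add_left _ _

lemma cost_nonneg (hτ : IsNorm τ) (T : Shape) : ∀ p, 0 ≤ cost τ T p := by
  induction T with
  | leaf e => intro p; exact tnonneg hτ _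
  | node S T h1 h2 =>
    intro p
    exact Real.iInf_nonneg fun q => add_nonneg (tnonneg hτ _) (add_nonneg (h1 q) (h2 q))

lemma cost_node_le (hτ : IsNorm τ) (S T : Shape) (p q : P2) :
    cost τ (.node S T) p ≤ τ (p - q) + (cost τ S q + cost τ T q) := by
  refine ciInf_le (f := fun q : P2 => (τ (p - q) + (cost τ S q + cost τ T q))) ⟨0, ?_⟩ q
  rintro _ ⟨q, rfl⟩
  exact add_nonneg (tnonneg hτ _) (add_nonneg (cost_nonneg hτ _ q) (cost_nonneg hτ _ q))

lemma cost_lip (hτ : IsNorm τ) (T : Shape) (p p' : P2) :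
    cost τ T p ≤ τ (p - p') + cost τ T p' := by
  cases T with
  | leaf e => exact ttri hτ _ _ _
  | node S T =>
    rw [← sub_le_iff_le_add']
    refine le_ciInf fun q => ?_
    have := cost_node_le hτ S T p q
    have := ttri hτ p p' q
    linarith

lemma cost_cont (hτ : IsNorm τ) (T : Shape) : Continuous (cost τ T) := by
  rw [continuous_iff_continuousAt]
  intro x
  have h0 : Filter.Tendsto (fun y => τ (y - x)) (nhds x) (nhds 0) := by
    have hc : Continuous fun y => τ (y - x) := (tcont hτ).comp (continuous_id.sub continuous_const)
    have := hc.tendsto x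
    simpa [tzero hτ] using this
  rw [ContinuousAt, tendsto_iff_dist_tendsto_zero]
  refine squeeze_zero (fun _ => dist_nonneg) (fun y => ?_) h0
  rw [Real.dist_eq, abs_le]
  have h1 := cost_lip hτ T y x
  have h2 := cost_lip hτ T x y
  rw [tcomm hτ x y] at h2
  constructor <;> linarith

lemma exists_min_of (hτ : IsNorm τ) (p : P2) (g : P2 → ℝ) (hg : Continuous g)
    (hb : ∀ q, τ (p - q) ≤ g q) : ∃ q, ∀ q', g q ≤ g q' := by
  obtain ⟨c, hc, hlow⟩ := tlower hτ
  refine hg.exists_forall_le ?_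
  have h1 : Filter.Tendsto (fun q : P2 => c * ‖q‖ - c * ‖p‖) (Filter.cocompact P2) Filter.atTop :=
    Filter.tendsto_atTop_add_const_right _ _
      ((tendsto_norm_cocompact_atTop).const_mul_atTop hc)
  refine Filter.tendsto_atTop_mono (fun q => ?_) h1
  refine le_trans ?_ (hb q)
  have h2 := hlow (p - q)
  have h3 : ‖q‖ - ‖p‖ ≤ ‖p - q‖ := by
    rw [norm_sub_rev]
    exact norm_sub_norm_le _ _
  nlinarith

lemma cost_attained (hτ : IsNorm τ) (S T : Shape) (p : P2) :
    ∃ q, cost τ (.node S T) p = τ (p - q) + (cost τ S q + cost τ T q) := by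
  obtain ⟨q, hq⟩ := exists_min_of hτ p (fun q => τ (p - q) + (cost τ S q + cost τ T q))
    (((tcont hτ).comp (continuous_const.sub continuous_id)).add
      ((cost_cont hτ S).add (cost_cont hτ T)))
    (fun q => by
      have := cost_nonneg hτ S q
      have := cost_nonneg hτ T q
      linarith)
  refine ⟨q, le_antisymm (cost_node_le hτ S T p q) (le_ciInf hq)⟩

/-- the cost is bounded below by the distance to some leaf -/
lemma cost_ge_leaf (hτ : IsNorm τ) (T : Shape) : ∃ e, ∀ p, τ (e - p) ≤ cost τ T p := by
  induction T with
  | leaf e => exact ⟨e, fun p => (tcomm hτ _ _).le⟩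
  | node S T h1 h2 =>
    obtain ⟨e, he⟩ := h1
    refine ⟨e, fun p => le_ciInf fun q => ?_⟩
    have := he q
    have := ttri hτ e q p
    rw [tcomm hτ q p] at this
    have := cost_nonneg hτ T q
    linarith

/-- Realization of a shape by an actual continuum. -/
lemma realize (hτ : IsNorm τ) (T : Shape) : ∀ p, ∃ F : Set P2, IsCompact F ∧ IsPreconnected F ∧
    p ∈ F ∧ (∀ e ∈ leaves T, e ∈ F) ∧ tauLen τ F ≤ ENNReal.ofReal (cost τ T p) := by
  have hseg : ∀ p q : P2, IsCompact (segment ℝ p q) := by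
    intro p q
    rw [segment_eq_image_lineMap]
    exact isCompact_Icc.image AffineMap.lineMap_continuous
  induction T with
  | leaf e =>
    intro p
    exact ⟨segment ℝ p e, hseg p e, (convex_segment p e).isPreconnected, left_mem_segment ℝ p e,
      by simpa [leaves] using right_mem_segment ℝ p e, len_segment hτ p e⟩
  | node S T h1 h2 =>
    intro p
    obtain ⟨q, hq⟩ := cost_attained hτ S T p
    obtain ⟨F, f1, f2, f3, f4, f5⟩ := h1 q
    obtain ⟨G, g1, g2, g3, g4, g5⟩ := h2 q
    refine ⟨segment ℝ p q ∪ (F ∪ G), (hseg p q).union (f1.union g1), ?_, ?_, ?_, ?_⟩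
    · exact (convex_segment p q).isPreconnected.union q (right_mem_segment ℝ p q) (Or.inl f3)
        (f2.union q f3 g3 g2)
    · exact Or.inl (left_mem_segment ℝ p q)
    · intro e he
      simp only [leaves, Multiset.mem_add] at he
      rcases he with he | he
      · exact Or.inr (Or.inl (f4 e he))
      · exact Or.inr (Or.inr (g4 e he))
    · rw [hq, ENNReal.ofReal_add (tnonneg hτ _)
        (add_nonneg (cost_nonneg hτ _ q) (cost_nonneg hτ _ q)),
        ENNReal.ofReal_add (cost_nonneg hτ _ q) (cost_nonneg hτ _ q)]
      exact (len_union _ _).trans (add_le_add (len_segment hτ p q)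
        ((len_union _ _).trans (add_le_add f5 g5)))

lemma exists_shape (X : Multiset P2) (hX : X ≠ 0) : ∃ T, leaves T = X := by
  induction X using Multiset.induction_on with
  | empty => exact absurd rfl hX
  | cons a X ih =>
    by_cases h : X = 0
    · exact ⟨.leaf a, by simp [leaves, h]⟩
    · obtain ⟨T, hT⟩ := ih h
      exact ⟨.node (.leaf a) T, by simp [leaves, hT]⟩

/-- The minimal cost of a connected set of terminals. -/
lemma exists_min (hτ : IsNorm τ) (X : Multiset P2) (hX : X ≠ 0) :
    ∃ m : ℝ, 0 ≤ m ∧ (∃ F : Set P2, IsCompact F ∧ IsPreconnected F ∧ (∀ e ∈ X, e ∈ F) ∧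
      tauLen τ F ≤ ENNReal.ofReal m) ∧ ∀ T p, leaves T = X → m ≤ cost τ T p := by
  have h1 : ∀ T, ∃ p, ∀ p', cost τ T p ≤ cost τ T p' := by
    intro T
    obtain ⟨e, he⟩ := cost_ge_leaf hτ T
    exact exists_min_of hτ e _ (cost_cont hτ T) he
  choose P hP using h1
  obtain ⟨T, hT, hmin⟩ := Set.exists_min_image {T | leaves T = X} (fun T => cost τ T (P T))
    (finite_shapes _ X rfl) (exists_shape X hX)
  refine ⟨cost τ T (P T), cost_nonneg hτ _ _, ?_, ?_⟩
  · obtain ⟨F, f1, f2, f3, f4, f5⟩ := realize hτ T (P T)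
    rw [hT] at f4
    exact ⟨F, f1, f2, f4, f5⟩
  · intro T' p hT'
    exact (hmin T' hT').trans (hP T' p)

lemma graft (hτ : IsNorm τ) (y : P2) (T' : Shape) (T : Shape) : ∀ X', leaves T = y ::ₘ X' →
    ∃ T'', leaves T'' = leaves T' + X' ∧ ∀ p, cost τ T'' p ≤ cost τ T p + cost τ T' y := by
  induction T with
  | leaf e =>
    intro X' h
    simp only [leaves] at h
    have hy : y ∈ ({e} : Multiset P2) := by
      rw [h]
      simp
    rw [Multiset.mem_singleton] at hy
    subst hy
    have hX : X' = 0 := by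
      have := congrArg Multiset.card h
      simpa using this
    exact ⟨T', by simp [hX], fun p => cost_lip hτ T' p y⟩
  | node S T h1 h2 =>
    intro X' h
    simp only [leaves] at h
    have hy : y ∈ leaves S + leaves T := by
      rw [h]
      simp
    rw [Multiset.mem_add] at hy
    rcases hy with hy | hy
    · obtain ⟨Y, hY⟩ := Multiset.exists_cons_of_mem hy
      obtain ⟨S', hS', hc⟩ := h1 Y hY
      refine ⟨.node S' T, ?_, ?_⟩
      · rw [hY, Multiset.cons_add, Multiset.cons_inj_right] at h
        simp only [leaves]
        rw [hS', ← h, add_assoc]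
      · intro p
        obtain ⟨q, hq⟩ := cost_attained hτ S T p
        have := cost_node_le hτ S' T p q
        have := hc q
        linarith
    · obtain ⟨Y, hY⟩ := Multiset.exists_cons_of_mem hy
      obtain ⟨S', hS', hc⟩ := h2 Y hY
      refine ⟨.node S S', ?_, ?_⟩
      · rw [hY, Multiset.add_cons, Multiset.cons_inj_right] at h
        simp only [leaves]
        rw [hS', ← h, add_left_comm]
      · intro p
        obtain ⟨q, hq⟩ := cost_attained hτ S T p
        have := cost_node_le hτ S S' p q
        have := hc q
        linarith

lemma star (hτ : IsNorm τ) (y : P2) (d : ℝ) (X : Multiset P2) (hX : X ≠ 0)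
    (h : ∀ x ∈ X, τ (y - x) ≤ d) : ∃ T, leaves T = X ∧ cost τ T y ≤ X.card * d := by
  induction X using Multiset.induction_on with
  | empty => exact absurd rfl hX
  | cons a X ih =>
    have ha : τ (y - a) ≤ d := h a (by simp)
    by_cases h0 : X = 0
    · exact ⟨.leaf a, by simp [leaves, h0], by simpa [cost, h0] using ha⟩
    · obtain ⟨T, hT, hc⟩ := ih h0 (fun x hx => h x (by simp [hx]))
      refine ⟨.node (.leaf a) T, by simp [leaves, hT], ?_⟩
      have h1 := cost_node_le hτ (.leaf a) T y y
      have h2 : cost τ (.leaf a) y ≤ d := ha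
      rw [sub_self, tzero hτ] at h1
      rw [Multiset.card_cons]
      push_cast
      linarith

/-- A set of cover elements is good if all terminals in it are cheap to connect. -/
def Good (τ : P2 → ℝ) (U : ℕ → Set P2) (d : ℕ → ℝ) (δ : ℝ) (J : Finset ℕ) : Prop :=
  ∀ X : Multiset P2, X ≠ 0 → (∀ x ∈ X, ∃ i ∈ J, x ∈ U i) →
    ∃ T p, leaves T = X ∧ cost τ T p ≤ ∑ i ∈ J, d i + (X.card - 1) * δ

lemma good_singleton (hτ : IsNorm τ) (U : ℕ → Set P2) (d : ℕ → ℝ) (δ : ℝ)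
    (hd : ∀ i, ∀ x ∈ U i, ∀ y ∈ U i, τ (x - y) ≤ d i) (hδ : ∀ i, d i ≤ δ) (i : ℕ) :
    Good τ U d δ {i} := by
  intro X hX hXU
  obtain ⟨y, hy⟩ := Multiset.exists_mem_of_ne_zero hX
  have hU : ∀ x ∈ X, x ∈ U i := fun x hx => by simpa using hXU x hx
  obtain ⟨T, hT, hc⟩ := star hτ y (d i) X hX (fun x hx => hd i _ (hU y hy) _ (hU x hx))
  refine ⟨T, y, hT, ?_⟩
  have h1 : (1 : ℝ) ≤ X.card := by
    exact_mod_cast Multiset.card_pos.2 hX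
  rw [Finset.sum_singleton]
  have := hδ i
  nlinarith

lemma good_insert (hτ : IsNorm τ) (U : ℕ → Set P2) (d : ℕ → ℝ) (δ : ℝ)
    (hd0 : ∀ i, 0 ≤ d i)
    (hd : ∀ i, ∀ x ∈ U i, ∀ y ∈ U i, τ (x - y) ≤ d i) (hδ : ∀ i, d i ≤ δ) (J : Finset ℕ)
    (hJ : Good τ U d δ J) (j : ℕ) (hj : j ∉ J) (y : P2) (hyj : y ∈ U j)
    (hyJ : ∃ i ∈ J, y ∈ U i) : Good τ U d δ (insert j J) := by
  classical
  intro X hX hXU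
  set X' := X.filter (fun x => ∃ i ∈ J, x ∈ U i) with hX'
  set Z := X.filter (fun x => ¬ ∃ i ∈ J, x ∈ U i) with hZ
  have hsum : X' + Z = X := Multiset.filter_add_not _ _
  have hX'U : ∀ x ∈ X', ∃ i ∈ J, x ∈ U i := fun x hx => (Multiset.mem_filter.1 hx).2
  have hZU : ∀ x ∈ Z, x ∈ U j := by
    intro x hx
    obtain ⟨h1, h2⟩ := Multiset.mem_filter.1 hx
    obtain ⟨i, hi, hxi⟩ := hXU x h1
    rcases Finset.mem_insert.1 hi with rfl | hi
    · exact hxi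
    · exact absurd ⟨i, hi, hxi⟩ h2
  rw [Finset.sum_insert hj]
  by_cases hZ0 : Z = 0
  · rw [hZ0, add_zero] at hsum
    obtain ⟨T, p, hT, hc⟩ := hJ X hX (by rw [← hsum]; exact hX'U)
    exact ⟨T, p, hT, by linarith [hd0 j]⟩
  · obtain ⟨T, p, hT, hc⟩ := hJ (y ::ₘ X') (Multiset.cons_ne_zero) (by
      intro x hx
      rcases Multiset.mem_cons.1 hx with rfl | hx
      · exact hyJ
      · exact hX'U x hx)
    obtain ⟨T', hT', hc'⟩ := star hτ y (d j) Z hZ0 (fun x hx => hd j _ hyj _ (hZU x hx))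
    obtain ⟨T'', hT'', hc''⟩ := graft hτ y T' T X' hT
    refine ⟨T'', p, by rw [hT'', hT', add_comm, hsum], ?_⟩
    have h1 : (1 : ℝ) ≤ Z.card := by
      exact_mod_cast Multiset.card_pos.2 hZ0
    have h2 := hc'' p
    have h3 : (X.card : ℝ) = X'.card + Z.card := by
      rw [← hsum]
      push_cast [Multiset.card_add]
      rfl
    rw [Multiset.card_cons] at hc
    push_cast at hc
    rw [h3]
    have := hδ j
    nlinarith

lemma good_all (hτ : IsNorm τ) (U : ℕ → Set P2) (d : ℕ → ℝ) (δ : ℝ)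
    (hd0 : ∀ i, 0 ≤ d i)
    (hd : ∀ i, ∀ x ∈ U i, ∀ y ∈ U i, τ (x - y) ≤ d i) (hδ : ∀ i, d i ≤ δ)
    (hU : ∀ i, IsOpen (U i)) (C : Set P2) (hC : IsPreconnected C) (I : Finset ℕ)
    (hI : I.Nonempty) (hCI : C ⊆ ⋃ i ∈ I, U i) (hmeet : ∀ i ∈ I, (C ∩ U i).Nonempty) :
    Good τ U d δ I := by
  classical
  obtain ⟨i0, hi0⟩ := hI
  let 𝒢 := I.powerset.filter (fun J => J.Nonempty ∧ Good τ U d δ J)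
  have hne : 𝒢.Nonempty := ⟨{i0}, by
    simp only [𝒢, Finset.mem_filter, Finset.mem_powerset, Finset.singleton_subset_iff]
    exact ⟨hi0, by simp, good_singleton hτ U d δ hd hδ i0⟩⟩
  obtain ⟨J, hJ, hmax⟩ := Finset.exists_max_image 𝒢 Finset.card hne
  simp only [𝒢, Finset.mem_filter, Finset.mem_powerset] at hJ hmax
  obtain ⟨hJI, ⟨i1, hi1⟩, hJg⟩ := hJ
  by_cases hEq : J = I
  · exact hEq ▸ hJg
  exfalso
  obtain ⟨j1, hj1I, hj1J⟩ : ∃ j ∈ I, j ∉ J := by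
    by_contra hcon
    push Not at hcon
    exact hEq (Finset.Subset.antisymm hJI hcon)
  have := hC (⋃ i ∈ J, U i) (⋃ i ∈ I \ J, U i) (isOpen_biUnion fun i _ => hU i)
    (isOpen_biUnion fun i _ => hU i) (by
      intro x hx
      obtain ⟨i, hi, hxi⟩ := Set.mem_iUnion₂.1 (hCI hx)
      by_cases h : i ∈ J
      · exact Or.inl (Set.mem_iUnion₂.2 ⟨i, h, hxi⟩)
      · exact Or.inr (Set.mem_iUnion₂.2 ⟨i, by simp [hi, h], hxi⟩))
    (by
      obtain ⟨x, hx, hx'⟩ := hmeet i1 (hJI hi1)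
      exact ⟨x, hx, Set.mem_iUnion₂.2 ⟨i1, hi1, hx'⟩⟩)
    (by
      obtain ⟨x, hx, hx'⟩ := hmeet j1 hj1I
      exact ⟨x, hx, Set.mem_iUnion₂.2 ⟨j1, by simp [hj1I, hj1J], hx'⟩⟩)
  obtain ⟨y, _, hy1, hy2⟩ := this
  obtain ⟨i, hi, hyi⟩ := Set.mem_iUnion₂.1 hy1
  obtain ⟨j, hj, hyj⟩ := Set.mem_iUnion₂.1 hy2
  rw [Finset.mem_sdiff] at hj
  have hg := good_insert hτ U d δ hd0 hd hδ J hJg j hj.2 y hyj ⟨i, hi, hyi⟩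
  have := hmax (insert j J) ⟨Finset.insert_subset hj.1 hJI, by simp, hg⟩
  rw [Finset.card_insert_of_notMem hj.2] at this
  omega


lemma separated (hτ : IsNorm τ) {A B : Set P2} (hA : IsCompact A) (hB : IsCompact B)
    (hAB : Disjoint A B) : ∃ s > 0, ∀ x ∈ A, ∀ y ∈ B, s ≤ τ (x - y) := by
  by_cases hne : (A ×ˢ B).Nonempty
  · have hc : Continuous fun z : P2 × P2 => τ (z.1 - z.2) :=
      (tcont hτ).comp (continuous_fst.sub continuous_snd)
    obtain ⟨z, hz, hmin⟩ := (hA.prod hB).exists_isMinOn hne hc.continuousOn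
    refine ⟨τ (z.1 - z.2), lt_of_le_of_ne (tnonneg hτ _) ?_, ?_⟩
    · intro h
      have h0 := sub_eq_zero.1 ((hτ.eq_zero_iff _).1 h.symm)
      exact Set.disjoint_left.1 hAB hz.1 (h0 ▸ hz.2)
    · intro x hx y hy
      exact hmin (show (x, y) ∈ A ×ˢ B from ⟨hx, hy⟩)
  · exact ⟨1, one_pos, fun x hx y hy => absurd ⟨(x, y), hx, hy⟩ hne⟩

lemma lower (hτ : IsNorm τ) {κ : Type*} [DecidableEq κ] (K : Finset κ) (C : κ → Set P2)
    (S : Set P2) (hCS : ∀ c ∈ K, C c ⊆ S) (hcomp : ∀ c ∈ K, IsCompact (C c))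
    (hconn : ∀ c ∈ K, IsPreconnected (C c))
    (hdisj : ∀ c ∈ K, ∀ c' ∈ K, c ≠ c' → Disjoint (C c) (C c'))
    (X : κ → Multiset P2) (hX0 : ∀ c ∈ K, X c ≠ 0) (hXC : ∀ c ∈ K, ∀ x ∈ X c, x ∈ C c)
    (m : κ → ℝ) (hm : ∀ c ∈ K, ∀ T p, leaves T = X c → m c ≤ cost τ T p) :
    ENNReal.ofReal (∑ c ∈ K, m c) ≤ tauLen τ S := by
  by_cases htop : tauLen τ S = ⊤
  · rw [htop]
    exact le_top
  set L := (tauLen τ S).toReal with hL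
  set N : ℝ := ∑ c ∈ K, ((X c).card : ℝ) with hN
  refine (ENNReal.ofReal_le_iff_le_toReal htop).2 ?_
  have hsep : ∀ᶠ δ : ℝ in nhdsWithin 0 (Set.Ioi 0), ∀ c ∈ K, ∀ c' ∈ K, c ≠ c' →
      ∀ x ∈ C c, ∀ y ∈ C c', 3 * δ < τ (x - y) := by
    rw [Filter.eventually_all_finset]
    intro c hc
    rw [Filter.eventually_all_finset]
    intro c' hc'
    by_cases hcc : c = c'
    · exact Filter.Eventually.of_forall fun δ h => absurd hcc h
    obtain ⟨s, hs, hsep⟩ := separated hτ (hcomp c hc) (hcomp c' hc') (hdisj c hc c' hc' hcc)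
    have : ∀ᶠ δ : ℝ in nhdsWithin 0 (Set.Ioi 0), δ < s / 3 :=
      nhdsWithin_le_nhds (gt_mem_nhds (by positivity))
    filter_upwards [this] with δ hδ _ x hx y hy
    have := hsep x hx y hy
    linarith
  have key : ∀ᶠ δ : ℝ in nhdsWithin 0 (Set.Ioi 0), ∑ c ∈ K, m c ≤ L + (3 + 3 * N) * δ := by
    filter_upwards [hsep, self_mem_nhdsWithin] with δ hs hδ
    replace hδ : 0 < δ := hδ
    have hδ' : ENNReal.ofReal δ ≠ 0 := by simpa using hδ
    obtain ⟨A, a1, a2, a3⟩ := exists_cover (ENNReal.lt_add_right htop hδ') hδ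
    obtain ⟨η, hη, hηs⟩ := ENNReal.exists_pos_sum_of_countable hδ' ℕ
    have hAtop : ∀ i, tauDiam τ (A i) ≠ ⊤ := fun i =>
      ne_top_of_le_ne_top ENNReal.ofReal_ne_top (a2 i)
    let U : ℕ → Set P2 := fun i => ⋃ a ∈ A i, {x | τ (x - a) < η i}
    let d : ℕ → ℝ := fun i => (tauDiam τ (A i)).toReal + 2 * η i
    have hUo : ∀ i, IsOpen (U i) := fun i => isOpen_biUnion fun a _ =>
      isOpen_lt ((tcont hτ).comp (continuous_id.sub continuous_const)) continuous_const
    have hAU : ∀ i, A i ⊆ U i := by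
      intro i x hx
      refine Set.mem_iUnion₂.2 ⟨x, hx, ?_⟩
      simp only [Set.mem_ofPred_eq, sub_self, tzero hτ]
      exact_mod_cast hη i
    have hd0 : ∀ i, 0 ≤ d i := fun i => by positivity
    have hd : ∀ i, ∀ x ∈ U i, ∀ y ∈ U i, τ (x - y) ≤ d i := by
      intro i x hx y hy
      obtain ⟨a, ha, hxa⟩ := Set.mem_iUnion₂.1 hx
      obtain ⟨b, hb, hyb⟩ := Set.mem_iUnion₂.1 hy
      simp only [Set.mem_ofPred_eq] at hxa hyb
      have h1 := ttri hτ x a y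
      have h2 := ttri hτ a b y
      rw [tcomm hτ b y] at h2
      have h3 : τ (a - b) ≤ (tauDiam τ (A i)).toReal :=
        (ENNReal.ofReal_le_iff_le_toReal (hAtop i)).1 (tau_le_diam ha hb)
      simp only [d]
      linarith
    have hη1 : ∀ t : Finset ℕ, ∑ i ∈ t, (η i : ℝ) ≤ δ := by
      intro t
      have h1 : ∑ i ∈ t, (η i : ℝ≥0∞) ≤ ENNReal.ofReal δ :=
        (ENNReal.sum_le_tsum t).trans hηs.le
      have h2 := ENNReal.toReal_mono ENNReal.ofReal_ne_top h1
      rw [ENNReal.toReal_sum (fun i _ => ENNReal.coe_ne_top), ENNReal.toReal_ofReal hδ.le] at h2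
      simpa using h2
    have hdδ : ∀ i, d i ≤ 3 * δ := by
      intro i
      have h1 := hη1 {i}
      rw [Finset.sum_singleton] at h1
      have h2 := ENNReal.toReal_mono ENNReal.ofReal_ne_top (a2 i)
      rw [ENNReal.toReal_ofReal hδ.le] at h2
      simp only [d]
      linarith
    have hdsum : ∀ t : Finset ℕ, ∑ i ∈ t, d i ≤ L + 3 * δ := by
      intro t
      have h1 : ∑ i ∈ t, tauDiam τ (A i) ≤ tauLen τ S + ENNReal.ofReal δ :=
        (ENNReal.sum_le_tsum t).trans a3.le
      have h2 := ENNReal.toReal_mono (ENNReal.add_ne_top.2 ⟨htop, ENNReal.ofReal_ne_top⟩) h1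
      rw [ENNReal.toReal_sum (fun i _ => hAtop i), ENNReal.toReal_add htop ENNReal.ofReal_ne_top,
        ENNReal.toReal_ofReal hδ.le] at h2
      have h3 := hη1 t
      simp only [d, Finset.sum_add_distrib, ← Finset.mul_sum]
      linarith
    have hI : ∀ c ∈ K, ∃ I : Finset ℕ, I.Nonempty ∧ C c ⊆ ⋃ i ∈ I, U i ∧
        ∀ i ∈ I, (C c ∩ U i).Nonempty := by
      intro c hc
      classical
      have hcov : C c ⊆ ⋃ i, U i := (hCS c hc).trans (a1.trans (Set.iUnion_mono hAU))
      obtain ⟨t, ht⟩ := (hcomp c hc).elim_finite_subcover U hUo hcov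
      have hsub : C c ⊆ ⋃ i ∈ t.filter (fun i => (C c ∩ U i).Nonempty), U i := by
        intro x hx
        obtain ⟨i, hi, hxi⟩ := Set.mem_iUnion₂.1 (ht hx)
        exact Set.mem_iUnion₂.2 ⟨i, Finset.mem_filter.2 ⟨hi, x, hx, hxi⟩, hxi⟩
      refine ⟨_, ?_, hsub, fun i hi => (Finset.mem_filter.1 hi).2⟩
      obtain ⟨x, hx⟩ := Multiset.exists_mem_of_ne_zero (hX0 c hc)
      obtain ⟨i, hi, _⟩ := Set.mem_iUnion₂.1 (hsub (hXC c hc x hx))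
      exact ⟨i, hi⟩
    choose! I hIne hIcov hImeet using hI
    have hmc : ∀ c ∈ K, m c ≤ ∑ i ∈ I c, d i + (X c).card * (3 * δ) := by
      intro c hc
      obtain ⟨T, p, hT, hcost⟩ := good_all hτ U d (3 * δ) hd0 hd hdδ hUo (C c) (hconn c hc) (I c)
        (hIne c hc) (hIcov c hc) (hImeet c hc) (X c) (hX0 c hc)
        (fun x hx => by simpa using hIcov c hc (hXC c hc x hx))
      have := hm c hc T p hT
      linarith
    have hpd : (K : Set κ).PairwiseDisjoint I := by
      intro c hc c' hc' hcc
      refine Finset.disjoint_left.2 fun i hi hi' => ?_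
      obtain ⟨x, hx, hxU⟩ := hImeet c hc i hi
      obtain ⟨y, hy, hyU⟩ := hImeet c' hc' i hi'
      have h1 := hs c hc c' hc' hcc x hx y hy
      have h2 := hd i x hxU y hyU
      have h3 := hdδ i
      linarith
    calc ∑ c ∈ K, m c ≤ ∑ c ∈ K, (∑ i ∈ I c, d i + (X c).card * (3 * δ)) :=
          Finset.sum_le_sum hmc
      _ = ∑ i ∈ K.biUnion I, d i + N * (3 * δ) := by
          rw [Finset.sum_add_distrib, Finset.sum_biUnion hpd, hN, Finset.sum_mul]
      _ ≤ L + (3 + 3 * N) * δ := by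
          have := hdsum (K.biUnion I)
          linarith
  have hlim : Filter.Tendsto (fun δ : ℝ => L + (3 + 3 * N) * δ) (nhdsWithin 0 (Set.Ioi 0))
      (nhds L) := by
    have hc : Continuous fun δ : ℝ => L + (3 + 3 * N) * δ := by fun_prop
    have := (hc.tendsto 0).mono_left (nhdsWithin_le_nhds (s := Set.Ioi 0))
    simpa using this
  exact ge_of_tendsto hlim key

lemma compact_component {S : Set P2} (hS : IsCompact S) (x : P2) :
    IsCompact (connectedComponentIn S x) := by
  by_cases hx : x ∈ S
  · refine hS.of_isClosed_subset ?_ (connectedComponentIn_subset S x)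
    have hsub : closure (connectedComponentIn S x) ⊆ S :=
      closure_minimal (connectedComponentIn_subset S x) hS.isClosed
    have := isPreconnected_connectedComponentIn (x := x) (F := S) |>.closure
      |>.subset_connectedComponentIn (subset_closure (mem_connectedComponentIn hx)) hsub
    exact isClosed_of_closure_subset this
  · rw [connectedComponentIn_eq_empty hx]
    exact isCompact_empty

end Steiner

/-- For a norm `τ` on `ℝ²`, a nonempty finite `E ⊂ ℝ²` and a partition
`E̲` of `E`, one has `τ_{E̲} < ∞` and the infimum is attained by a compact `F ∈ Ω_{E̲}`,
which can moreover be chosen so that every connected component of `F` contains a point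
of `E`. -/
theorem statement12 (τ : P2 → ℝ) (hτ : IsNorm τ) (E : Set P2) (hEfin : E.Finite)
    (hEne : E.Nonempty) (r : ℕ) (Ep : Fin r → Set P2) (hpart : IsPartitionOf Ep E) :
    tauMin τ Ep < ⊤ ∧
    ∃ F ∈ OmegaSet Ep, tauLen τ F = tauMin τ Ep ∧
      ∀ x ∈ F, (connectedComponentIn F x ∩ E).Nonempty := by
  classical
  obtain ⟨hne, hdis, hun⟩ := hpart
  have hEpE : ∀ j, Ep j ⊆ E := fun j => hun ▸ Set.subset_iUnion Ep j
  have hEpfin : ∀ j, (Ep j).Finite := fun j => hEfin.subset (hEpE j)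
  -- the terminals in class `c` of the grouping `φ`
  let G : (Fin r → Fin r) → Fin r → Finset P2 := fun φ c =>
    (Finset.univ.filter (fun j => φ j = c)).biUnion (fun j => (hEpfin j).toFinset)
  have hG : ∀ φ c x, x ∈ G φ c ↔ ∃ j, φ j = c ∧ x ∈ Ep j := by
    intro φ c x
    simp [G]
  choose! M hM0 F0 hMmin using fun X => Steiner.exists_min (τ := τ) hτ X
  choose! F hFc hFconn hFX hFlen using F0
  let K : (Fin r → Fin r) → Finset (Fin r) := fun φ => Finset.univ.image φ
  have hG0 : ∀ φ, ∀ c ∈ K φ, (G φ c).val ≠ 0 := by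
    intro φ c hc
    obtain ⟨j, _, hj⟩ := Finset.mem_image.1 hc
    obtain ⟨x, hx⟩ := hne j
    intro h
    have : x ∈ (G φ c).val := (hG φ c x).2 ⟨j, hj, hx⟩
    rw [h] at this
    simp at this
  let a : (Fin r → Fin r) → ℝ := fun φ => ∑ c ∈ K φ, M (G φ c).val
  obtain ⟨φ, -, hφ⟩ := Finset.exists_min_image (Finset.univ : Finset (Fin r → Fin r)) a
    ⟨id, Finset.mem_univ _⟩
  let F1 : Set P2 := ⋃ c ∈ K φ, F (G φ c).val
  have hK : ∀ j, φ j ∈ K φ := fun j => Finset.mem_image.2 ⟨j, Finset.mem_univ _, rfl⟩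
  have hsub : ∀ c ∈ K φ, F (G φ c).val ⊆ F1 := fun c hc x hx => Set.mem_iUnion₂.2 ⟨c, hc, hx⟩
  have hEF : ∀ j, ∀ x ∈ Ep j, x ∈ F (G φ (φ j)).val := fun j x hx =>
    hFX _ (hG0 φ _ (hK j)) x ((hG φ _ x).2 ⟨j, rfl, hx⟩)
  have hF1 : F1 ∈ OmegaSet Ep := by
    refine ⟨(K φ).isCompact_biUnion fun c hc => hFc _ (hG0 φ c hc), fun j => ?_⟩
    obtain ⟨x, hx⟩ := hne j
    refine ⟨x, hsub _ (hK j) (hEF j x hx), fun y hy => ?_⟩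
    exact (hFconn _ (hG0 φ _ (hK j))).subset_connectedComponentIn (hEF j x hx)
      (hsub _ (hK j)) (hEF j y hy)
  have hlen : tauLen τ F1 ≤ ENNReal.ofReal (a φ) := by
    refine (Steiner.len_biUnion _ _).trans ?_
    rw [ENNReal.ofReal_sum_of_nonneg fun c hc => hM0 _ (hG0 φ c hc)]
    exact Finset.sum_le_sum fun c hc => hFlen _ (hG0 φ c hc)
  have hlow : ∀ S ∈ OmegaSet Ep, ENNReal.ofReal (a φ) ≤ tauLen τ S := by
    rintro S ⟨hSc, hS⟩
    choose x hxS hx using hS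
    let h : Fin r → Set P2 := fun j => connectedComponentIn S (x j)
    have hrep : ∃ ψ : Fin r → Fin r, (∀ j, h (ψ j) = h j) ∧
        ∀ j k, h j = h k → ψ j = ψ k := by
      have hex : ∀ j, ∃ k, h k = h j := fun j => ⟨j, rfl⟩
      refine ⟨fun j => if hr : ∃ k, h k = h j then hr.choose else j, fun j => ?_, fun j k hjk => ?_⟩
      · dsimp only
        rw [dif_pos (hex j)]
        exact (hex j).choose_spec
      · dsimp only
        rw [dif_pos (hex j), dif_pos (hex k)]
        simp only [hjk]
    obtain ⟨ψ, hψ1, hψ2⟩ := hrep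
    refine (ENNReal.ofReal_le_ofReal (hφ ψ (Finset.mem_univ _))).trans ?_
    refine Steiner.lower hτ (K ψ) h S (fun c _ => connectedComponentIn_subset _ _)
      (fun c _ => Steiner.compact_component hSc _)
      (fun c _ => isPreconnected_connectedComponentIn) ?_ (fun c => (G ψ c).val)
      (fun c hc => hG0 ψ c hc) ?_ (fun c => M (G ψ c).val)
      (fun c hc => hMmin _ (hG0 ψ c hc))
    · intro c hc c' hc' hcc
      obtain ⟨j, _, rfl⟩ := Finset.mem_image.1 hc
      obtain ⟨k, _, rfl⟩ := Finset.mem_image.1 hc'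
      refine Set.disjoint_left.2 fun z hz hz' => hcc (hψ2 j k ?_)
      rw [← hψ1 j, ← hψ1 k]
      exact (connectedComponentIn_eq hz).trans (connectedComponentIn_eq hz').symm
    · intro c hc y hy
      obtain ⟨j, hj, hyj⟩ := (hG ψ c y).1 hy
      rw [← hj, hψ1 j]
      exact hx j hyj
  have hmin : tauLen τ F1 = tauMin τ Ep :=
    le_antisymm (le_iInf₂ fun S hS => hlen.trans (hlow S hS)) (iInf₂_le F1 hF1)
  refine ⟨?_, F1, hF1, hmin, ?_⟩
  · rw [← hmin]
    exact lt_of_le_of_lt hlen ENNReal.ofReal_lt_top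
  · intro x hx
    obtain ⟨c, hc, hxc⟩ := Set.mem_iUnion₂.1 hx
    obtain ⟨j, _, rfl⟩ := Finset.mem_image.1 hc
    obtain ⟨y, hy⟩ := hne j
    exact ⟨y, (hFconn _ (hG0 φ _ hc)).subset_connectedComponentIn hxc (hsub _ hc) (hEF j y hy),
      hEpE j hy⟩
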